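/- Let Q = [B | C] be an ice quiver and v a mutable vertex such that the mutable subquiver of μ_v(Q) is a fork with point of return v. Write [B^{[v]} | C^{[v]}] = μ_v([B | C]), and suppose: (1) every mutable vertex of μ_v(Q) is red or green; (2) if every entry of b^{[v]}_{vj}·c^{[v]}_j is ≥ 0 for some mutable j ≠ v, then sgn(c^{[v]}_j) = sgn(c^{[v]}_v) or sgn(c^{[v]}_j)·c^{[v]}_j ≥ sgn(c^{[v]}_v)·c^{[v]}_v entrywise; (3) if every entry of b^{[v]}_{vj}·c^{[v]}_j is ≤ 0 for some mutable j ≠ v, then sgn(c^{[v]}_j) = -sgn(c^{[v]}_v); (4) if every entry of b^{[v]}_{ij}·c^{[v]}_j is ≥ 0 for distinct mutable i, j both different from v, then sgn(c^{[v]}_i) = sgn(c^{[v]}_j). Then for every reduced mutation sequence w beginning with v, writing r for the last vertex of w and [B^w | C^w] = μ_w([B | C]): every mutable vertex of μ_w(Q) is red or green; if every entry of b^w_{rj}·c^w_j is ≥ 0 for some mutable j ≠ r, then sgn(c^w_j) = sgn(c^w_r) or sgn(c^w_j)·c^w_j ≥ sgn(c^w_r)·c^w_r entrywise; if every entry of b^w_{rj}·c^w_j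 is ≤ 0 for some mutable j ≠ r, then sgn(c^w_j) = -sgn(c^w_r); and if every entry of b^w_{ij}·c^w_j is ≥ 0 for distinct mutable i, j both different from r, then sgn(c^w_i) = sgn(c^w_j). -/

import Mathlib

open Matrix

section QuiverDefs

variable {V W : Type*}

/-- Mutation of an exchange matrix at the vertex `k`. -/
def mutB [DecidableEq V] (B : Matrix V V ℤ) (k : V) : Matrix V V ℤ :=
  Matrix.of fun i j =>
    if i = k ∨ j = k then -B i j else B i j + (B i k).sign * max (B i k * B k j) 0

/-- Mutation of the `C`-matrix of an extended exchange matrix `[B | C]` at the vertex `k`. -/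
def mutC [DecidableEq V] (B : Matrix V V ℤ) (C : Matrix V W ℤ) (k : V) : Matrix V W ℤ :=
  Matrix.of fun i j =>
    if i = k then -C i j else C i j + (B i k).sign * max (B i k * C k j) 0

/-- One mutation step on an extended exchange matrix `[B | C]`, regarded as a pair `(B, C)`. -/
def mutPair [DecidableEq V] (P : Matrix V V ℤ × Matrix V W ℤ) (k : V) :
    Matrix V V ℤ × Matrix V W ℤ :=
  (mutB P.1 k, mutC P.1 P.2 k)

/-- Iterated mutation of an extended exchange matrix along a list of mutable vertices. -/
def mutSeqPair [DecidableEq V] (P : Matrix V V ℤ × Matrix V W ℤ) (w : List V) :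
    Matrix V V ℤ × Matrix V W ℤ :=
  w.foldl mutPair P

/-- Iterated mutation of an exchange matrix along a list of vertices. -/
def mutSeqB [DecidableEq V] (B : Matrix V V ℤ) (w : List V) : Matrix V V ℤ :=
  w.foldl mutB B

/-- A quiver is abundant if there are at least two arrows between any two distinct vertices. -/
def QAbundant (B : Matrix V V ℤ) : Prop := ∀ i j, i ≠ j → 2 ≤ |B i j|

/-- There is a directed cycle of the quiver `B` all of whose vertices lie in `S`. -/
def HasCycleIn (B : Matrix V V ℤ) (S : Set V) : Prop :=
  ∃ (x : V) (l : List V), x ∈ S ∧ (∀ y ∈ l, y ∈ S) ∧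
    List.Chain (fun i j => 0 < B i j) x (l ++ [x])

/-- A quiver is acyclic if it has no directed cycle. -/
def QAcyclic (B : Matrix V V ℤ) : Prop := ¬ HasCycleIn B Set.univ

/-- The vertex `x` is a source: all arrows at `x` point away from `x`. -/
def QSource (B : Matrix V V ℤ) (x : V) : Prop := ∀ j, 0 ≤ B x j

/-- The vertex `x` is a sink: all arrows at `x` point into `x`. -/
def QSink (B : Matrix V V ℤ) (x : V) : Prop := ∀ j, B x j ≤ 0

/-- `B` is a fork with point of return `r`: it is abundant, not acyclic, the full subquiver
obtained by deleting `r` is acyclic, and for all `i` with `i → r` and `j` with `r → j` one has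
`b_{ji} > b_{ir}` and `b_{ji} > b_{rj}`. -/
def QFork (B : Matrix V V ℤ) (r : V) : Prop :=
  QAbundant B ∧ ¬ QAcyclic B ∧ ¬ HasCycleIn B {x | x ≠ r} ∧
    ∀ i j, 0 < B i r → 0 < B r j → B i r < B j i ∧ B r j < B j i

/-- The mutable vertex `i` is green: its `c`-vector is nonzero with all entries `≥ 0`. -/
def QGreen (C : Matrix V W ℤ) (i : V) : Prop := (∀ j, 0 ≤ C i j) ∧ C i ≠ 0

/-- The mutable vertex `i` is red: its `c`-vector is nonzero with all entries `≤ 0`. -/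
def QRed (C : Matrix V W ℤ) (i : V) : Prop := (∀ j, C i j ≤ 0) ∧ C i ≠ 0

/-- The mutable vertex `i` is blue: its `c`-vector is zero. -/
def QBlue (C : Matrix V W ℤ) (i : V) : Prop := C i = 0

/-- `i` has the same color (red/green/blue) with respect to `C` and to `C'`. -/
def SameColorQ (C C' : Matrix V W ℤ) (i : V) : Prop :=
  (QRed C i ↔ QRed C' i) ∧ (QGreen C i ↔ QGreen C' i) ∧ (QBlue C i ↔ QBlue C' i)

/-- The `c`-vectors of `i` and `j` have the same sign (`sgn(c_i) = sgn(c_j)`). -/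
def SameSignQ (C : Matrix V W ℤ) (i j : V) : Prop :=
  (QGreen C i ∧ QGreen C j) ∨ (QRed C i ∧ QRed C j)

/-- The `c`-vectors of `i` and `j` have opposite signs (`sgn(c_i) = -sgn(c_j)`). -/
def OppSignQ (C : Matrix V W ℤ) (i j : V) : Prop :=
  (QGreen C i ∧ QRed C j) ∨ (QRed C i ∧ QGreen C j)

/-- An ice quiver is uniformly sign-coherent if after every mutation sequence every mutable
vertex is red, green, or blue, and not every mutable vertex of the initial quiver is blue. -/
def USC [DecidableEq V] (P : Matrix V V ℤ × Matrix V W ℤ) : Prop :=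
  (∀ (w : List V) (i : V),
      QRed (mutSeqPair P w).2 i ∨ QGreen (mutSeqPair P w).2 i ∨ QBlue (mutSeqPair P w).2 i) ∧
    ¬ ∀ i, QBlue P.2 i

/-- An ice quiver is strictly sign-coherent if after every mutation sequence every mutable
vertex is red or green. -/
def SSC [DecidableEq V] (P : Matrix V V ℤ × Matrix V W ℤ) : Prop :=
  ∀ (w : List V) (i : V), QRed (mutSeqPair P w).2 i ∨ QGreen (mutSeqPair P w).2 i

/-- The four sign conditions at the distinguished vertex `r`:
(1) every mutable vertex is red or green;
(2) if every entry of `b_{rj}·c_j` is `≥ 0` for some `j ≠ r`, then `sgn(c_j) = sgn(c_r)` or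
    `sgn(c_j)·c_j ≥ sgn(c_r)·c_r` entrywise (i.e. `|c_r| ≤ |c_j|` entrywise);
(3) if every entry of `b_{rj}·c_j` is `≤ 0` for some `j ≠ r`, then `sgn(c_j) = -sgn(c_r)`;
(4) if every entry of `b_{ij}·c_j` is `≥ 0` for distinct `i, j` both `≠ r`,
    then `sgn(c_i) = sgn(c_j)`. -/
def FourConds (Bw : Matrix V V ℤ) (Cw : Matrix V W ℤ) (r : V) : Prop :=
  (∀ i, QRed Cw i ∨ QGreen Cw i) ∧
  (∀ j, j ≠ r → (∀ t, 0 ≤ Bw r j * Cw j t) →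
    (SameSignQ Cw j r ∨ ∀ t, |Cw r t| ≤ |Cw j t|)) ∧
  (∀ j, j ≠ r → (∀ t, Bw r j * Cw j t ≤ 0) → OppSignQ Cw j r) ∧
  (∀ i j, i ≠ j → i ≠ r → j ≠ r → (∀ t, 0 ≤ Bw i j * Cw j t) → SameSignQ Cw i j)

end QuiverDefs

section Aux

variable {V W : Type*}

/-- The combinatorial facts about forks that are propagated. -/
structure FInv (B : Matrix V V ℤ) (r : V) : Prop where
  sk : ∀ i j, B j i = -B i j
  ab : ∀ i j, i ≠ j → 2 ≤ B i j ∨ B i j ≤ -2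
  tr : ∀ i j l, i ≠ r → j ≠ r → l ≠ r → 0 < B i j → 0 < B j l → 0 < B l i → False
  fk : ∀ i j, 0 < B i r → 0 < B r j → B i r < B j i ∧ B r j < B j i

/-- Sign conditions, split according to the directions of arrows. -/
structure SInv (B : Matrix V V ℤ) (C : Matrix V W ℤ) (r : V) : Prop where
  s1 : ∀ i, QRed C i ∨ QGreen C i
  s2 : ∀ j, j ≠ r → 0 < B r j → QGreen C j → QGreen C r ∨ ∀ t, |C r t| ≤ |C j t|
  s2' : ∀ j, j ≠ r → B r j < 0 → QRed C j → QRed C r ∨ ∀ t, |C r t| ≤ |C j t|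
  s3 : ∀ j, j ≠ r → 0 < B r j → QRed C j → QGreen C r
  s3' : ∀ j, j ≠ r → B r j < 0 → QGreen C j → QRed C r
  s4 : ∀ i j, i ≠ j → i ≠ r → j ≠ r → 0 < B i j → QGreen C j → QGreen C i
  s4' : ∀ i j, i ≠ j → i ≠ r → j ≠ r → B i j < 0 → QRed C j → QRed C i

theorem not_red_green {C : Matrix V W ℤ} {i : V} (h : QRed C i) (h' : QGreen C i) : False :=
  h.2 (funext fun t => le_antisymm (h.1 t) (h'.1 t))

theorem sInv_of_four {B : Matrix V V ℤ} {C : Matrix V W ℤ} {r : V}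
    (h : FourConds B C r) : SInv B C r := by
  obtain ⟨h1, h2, h3, h4⟩ := h
  refine ⟨h1, ?_, ?_, ?_, ?_, ?_, ?_⟩
  · intro j hj hb hg
    rcases h2 j hj (fun t => mul_nonneg hb.le (hg.1 t)) with (h | h) | h
    · exact Or.inl h.2
    · exact (not_red_green h.1 hg).elim
    · exact Or.inr h
  · intro j hj hb hg
    rcases h2 j hj (fun t => mul_nonneg_of_nonpos_of_nonpos hb.le (hg.1 t)) with (h | h) | h
    · exact (not_red_green hg h.1).elim
    · exact Or.inl h.2
    · exact Or.inr h
  · intro j hj hb hg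
    rcases h3 j hj (fun t => mul_nonpos_of_nonneg_of_nonpos hb.le (hg.1 t)) with h | h
    · exact (not_red_green hg h.1).elim
    · exact h.2
  · intro j hj hb hg
    rcases h3 j hj (fun t => mul_nonpos_of_nonpos_of_nonneg hb.le (hg.1 t)) with h | h
    · exact h.2
    · exact (not_red_green h.1 hg).elim
  · intro i j hij hi hj hb hg
    rcases h4 i j hij hi hj (fun t => mul_nonneg hb.le (hg.1 t)) with h | h
    · exact h.1
    · exact (not_red_green h.2 hg).elim
  · intro i j hij hi hj hb hg
    rcases h4 i j hij hi hj (fun t => mul_nonneg_of_nonpos_of_nonpos hb.le (hg.1 t)) with h | h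
    · exact (not_red_green hg h.2).elim
    · exact h.1

theorem four_of_sInv {B : Matrix V V ℤ} {C : Matrix V W ℤ} {r : V}
    (hF : FInv B r) (h : SInv B C r) : FourConds B C r := by
  have hne : ∀ i, C i ≠ 0 := fun i => (h.s1 i).elim (fun h => h.2) (fun h => h.2)
  refine ⟨h.s1, ?_, ?_, ?_⟩
  · intro j hj hp
    rcases hF.ab r j hj.symm with hb | hb
    · have hg : QGreen C j := ⟨fun t => by nlinarith [hp t], hne j⟩
      rcases h.s2 j hj (by omega) hg with h | h
      · exact Or.inl (Or.inl ⟨hg, h⟩)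
      · exact Or.inr h
    · have hg : QRed C j := ⟨fun t => by nlinarith [hp t], hne j⟩
      rcases h.s2' j hj (by omega) hg with h | h
      · exact Or.inl (Or.inr ⟨hg, h⟩)
      · exact Or.inr h
  · intro j hj hp
    rcases hF.ab r j hj.symm with hb | hb
    · have hg : QRed C j := ⟨fun t => by nlinarith [hp t], hne j⟩
      exact Or.inr ⟨hg, h.s3 j hj (by omega) hg⟩
    · have hg : QGreen C j := ⟨fun t => by nlinarith [hp t], hne j⟩
      exact Or.inl ⟨hg, h.s3' j hj (by omega) hg⟩
  · intro i j hij hi hj hp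
    rcases hF.ab i j hij with hb | hb
    · have hg : QGreen C j := ⟨fun t => by nlinarith [hp t], hne j⟩
      exact Or.inl ⟨h.s4 i j hij hi hj (by omega) hg, hg⟩
    · have hg : QRed C j := ⟨fun t => by nlinarith [hp t], hne j⟩
      exact Or.inr ⟨h.s4' i j hij hi hj (by omega) hg, hg⟩

variable [DecidableEq V]

theorem mutB_skew {B : Matrix V V ℤ} (sk : ∀ i j, B j i = -B i j) (k : V) :
    ∀ i j, mutB B k j i = -mutB B k i j := by
  intro i j
  simp only [mutB, Matrix.of_apply]
  by_cases h : i = k ∨ j = k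
  · rw [if_pos h, if_pos h.symm, sk i j]
  · rw [if_neg h, if_neg (fun h' => h h'.symm), sk i j, sk k j, sk i k]
    have e : -B k j * -B i k = B i k * B k j := by ring
    rw [e]
    rcases le_or_gt (B i k * B k j) 0 with hp | hp
    · rw [max_eq_right hp]; ring
    · rcases pos_and_pos_or_neg_and_neg_of_mul_pos hp with ⟨h1, h2⟩ | ⟨h1, h2⟩
      · rw [Int.sign_eq_one_of_pos h1, Int.sign_eq_neg_one_of_neg (by omega : -B k j < 0)]; ring
      · rw [Int.sign_eq_neg_one_of_neg h1, Int.sign_eq_one_of_pos (by omega : 0 < -B k j)]; ring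

theorem mutB_left (B : Matrix V V ℤ) (k j : V) : mutB B k k j = -B k j := by
  simp [mutB]

theorem mutB_right (B : Matrix V V ℤ) (k j : V) : mutB B k j k = -B j k := by
  simp [mutB]

theorem mutB_path {B : Matrix V V ℤ} {k i j : V} (hi : i ≠ k) (hj : j ≠ k)
    (h1 : 0 < B i k) (h2 : 0 < B k j) : mutB B k i j = B i j + B i k * B k j := by
  simp only [mutB, Matrix.of_apply]
  rw [if_neg (by tauto), max_eq_left (by positivity), Int.sign_eq_one_of_pos h1, one_mul]

theorem mutB_same {B : Matrix V V ℤ} {k i j : V} (hi : i ≠ k) (hj : j ≠ k)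
    (h : B i k * B k j ≤ 0) : mutB B k i j = B i j := by
  simp only [mutB, Matrix.of_apply]
  rw [if_neg (by tauto), max_eq_right h]; ring

/-- The key estimate: a path `i → k → j` yields many arrows `i → j` after mutation. -/
theorem path_big {B : Matrix V V ℤ} {r k : V} (h : FInv B r) (hk : k ≠ r) {i j : V}
    (hi : i ≠ k) (hj : j ≠ k) (h1 : 0 < B i k) (h2 : 0 < B k j) :
    B i k < mutB B k i j ∧ B k j < mutB B k i j := by
  rw [mutB_path hi hj h1 h2]
  have hij : i ≠ j := by
    rintro rfl
    have := h.sk i k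
    omega
  have a1 := h.ab i k hi
  have a2 := h.ab k j hj.symm
  have a3 := h.ab i j hij
  have a1' : 2 ≤ B i k := by omega
  have a2' : 2 ≤ B k j := by omega
  rcases a3 with a3 | a3
  · constructor <;> nlinarith
  · have e1 := h.sk i j
    by_cases hir : i = r
    · subst hir
      have := h.fk j k (by omega) h1
      constructor <;> nlinarith
    · by_cases hjr : j = r
      · subst hjr
        have := h.fk k i h2 (by omega)
        constructor <;> nlinarith
      · exact (h.tr i k j hir hk hjr h1 h2 (by omega)).elim

theorem in_same {B : Matrix V V ℤ} {r k : V} (h : FInv B r) {i j : V}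
    (hi : i ≠ k) (hj : j ≠ k) (h1 : 0 < B i k) (h2 : 0 < B j k) : mutB B k i j = B i j := by
  apply mutB_same hi hj
  have := h.sk j k
  exact mul_nonpos_of_nonneg_of_nonpos h1.le (by omega)

theorem out_same {B : Matrix V V ℤ} {r k : V} (h : FInv B r) {i j : V}
    (hi : i ≠ k) (hj : j ≠ k) (h1 : 0 < B k i) (h2 : 0 < B k j) : mutB B k i j = B i j := by
  apply mutB_same hi hj
  have := h.sk k i
  exact mul_nonpos_of_nonpos_of_nonneg (by omega) h2.le

theorem fInv_step {B : Matrix V V ℤ} {r k : V} (h : FInv B r) (hk : k ≠ r) :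
    FInv (mutB B k) k := by
  have sk' := mutB_skew h.sk k
  have dir : ∀ i, i ≠ k → 2 ≤ B i k ∨ 2 ≤ B k i := by
    intro i hi
    have := h.ab i k hi
    have := h.sk i k
    omega
  -- three-cycles inside the in-neighbours or out-neighbours must pass through `r`
  have cin : ∀ j l, 0 < B r k → 0 < B l k → 0 < B r j → 0 < B l r → False := by
    intro j l h1 h2 h3 h4
    have := h.fk l k h4 h1
    have := h.sk l k
    omega
  have cout : ∀ j l, 0 < B k r → 0 < B k j → 0 < B r j → 0 < B l r → False := by
    intro j l h1 h2 h3 h4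
    have := h.fk k j h1 h3
    have := h.sk k j
    omega
  have nob : ∀ i j, i ≠ k → j ≠ k → 0 < B k i → 0 < B j k → 0 < mutB B k i j → False := by
    intro i j hi hj h1 h2 h3
    have := path_big h hk hj hi h2 h1
    have := sk' i j
    omega
  refine ⟨sk', ?_, ?_, ?_⟩
  · intro i j hij
    by_cases hi : i = k
    · subst hi; rw [mutB_left]; have := h.ab i j hij; omega
    by_cases hj : j = k
    · subst hj; rw [mutB_right]; have := h.ab i j hij; omega
    rcases dir i hi with di | di <;> rcases dir j hj with dj | dj
    · rw [in_same h hi hj (by omega) (by omega)]; exact h.ab i j hij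
    · have := path_big h hk hi hj (by omega) (by omega); omega
    · have := path_big h hk hj hi (by omega) (by omega)
      have := sk' i j
      omega
    · rw [out_same h hi hj (by omega) (by omega)]; exact h.ab i j hij
  · intro i j l hi hj hl h1 h2 h3
    rcases dir i hi with di | di <;> rcases dir j hj with dj | dj <;>
      rcases dir l hl with dl | dl
    · rw [in_same h (by assumption) (by assumption) (by omega) (by omega)] at h1 h2 h3
      by_cases e1 : i = r
      · subst e1; exact cin j l (by omega) (by omega) h1 h3
      by_cases e2 : j = r
      · subst e2; exact cin l i (by omega) (by omega) h2 h1
      by_cases e3 : l = r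
      · subst e3; exact cin i j (by omega) (by omega) h3 h2
      exact h.tr i j l e1 e2 e3 h1 h2 h3
    · exact nob l i hl hi (by omega) (by omega) h3
    · exact nob j l hj hl (by omega) (by omega) h2
    · exact nob l i hl hi (by omega) (by omega) h3
    · exact nob i j hi hj (by omega) (by omega) h1
    · exact nob i j hi hj (by omega) (by omega) h1
    · exact nob j l hj hl (by omega) (by omega) h2
    · rw [out_same h (by assumption) (by assumption) (by omega) (by omega)] at h1 h2 h3
      by_cases e1 : i = r
      · subst e1; exact cout j l (by omega) (by omega) h1 h3
      by_cases e2 : j = r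
      · subst e2; exact cout l i (by omega) (by omega) h2 h1
      by_cases e3 : l = r
      · subst e3; exact cout i j (by omega) (by omega) h3 h2
      exact h.tr i j l e1 e2 e3 h1 h2 h3
  · intro i j h1 h2
    rw [mutB_right] at h1 ⊢
    rw [mutB_left] at h2 ⊢
    have hkk := h.sk k k
    have hi : i ≠ k := by rintro rfl; omega
    have hj : j ≠ k := by rintro rfl; omega
    have e1 := h.sk i k
    have e2 := h.sk j k
    have := path_big h hk hj hi (by omega) (by omega)
    omega

theorem mutC_self (B : Matrix V V ℤ) (C : Matrix V W ℤ) (k : V) : mutC B C k k = -C k := by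
  ext t; simp [mutC]

theorem mutC_in {B : Matrix V V ℤ} {C : Matrix V W ℤ} {k i : V} (hi : i ≠ k)
    (hg : QGreen C k) (h : 0 < B i k) (t : W) : mutC B C k i t = C i t + B i k * C k t := by
  simp only [mutC, Matrix.of_apply]
  rw [if_neg hi, max_eq_left (mul_nonneg h.le (hg.1 t)), Int.sign_eq_one_of_pos h, one_mul]

theorem mutC_out {B : Matrix V V ℤ} {C : Matrix V W ℤ} {k i : V} (hi : i ≠ k)
    (hg : QGreen C k) (h : B i k < 0) : mutC B C k i = C i := by
  ext t
  simp only [mutC, Matrix.of_apply]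
  rw [if_neg hi, max_eq_right (mul_nonpos_of_nonpos_of_nonneg h.le (hg.1 t))]; ring

theorem sInv_step_green {B : Matrix V V ℤ} {C : Matrix V W ℤ} {r k : V} (hF : FInv B r)
    (h : SInv B C r) (hk : k ≠ r) (hg : QGreen C k) : SInv (mutB B k) (mutC B C k) k := by
  have hF' := fInv_step hF hk
  have kred : QRed (mutC B C k) k := by
    refine ⟨fun t => ?_, ?_⟩
    · rw [mutC_self]; simpa using hg.1 t
    · rw [mutC_self]; simpa using hg.2
  have big : ∀ i, i ≠ k → 0 < B i k → ∀ t, C k t ≤ mutC B C k i t := by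
    intro i hi hb t
    rw [mutC_in hi hg hb]
    have hb2 : 2 ≤ B i k := by have := hF.ab i k hi; omega
    have hkt := hg.1 t
    by_cases hir : i = r
    · subst hir
      rcases h.s2 k hk hb hg with hh | hh
      · have := hh.1 t; nlinarith
      · have := hh t
        rw [abs_of_nonneg hkt] at this
        have := neg_abs_le (C i t)
        nlinarith
    · have := (h.s4 i k hi hir hk hb hg).1 t
      nlinarith
  have ingreen : ∀ i, i ≠ k → 0 < B i k → QGreen (mutC B C k) i := by
    intro i hi hb
    refine ⟨fun t => (hg.1 t).trans (big i hi hb t), fun h0 => hg.2 ?_⟩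
    funext t
    have h1 := big i hi hb t
    rw [h0] at h1
    exact le_antisymm h1 (hg.1 t)
  have outc : ∀ i, i ≠ k → B i k < 0 → mutC B C k i = C i := fun i hi hb => mutC_out hi hg hb
  -- main point
  have main : ∀ i j, i ≠ j → i ≠ k → j ≠ k → 0 < mutB B k i j → QGreen (mutC B C k) j →
      QRed (mutC B C k) i → False := by
    intro i j hij hi hj hb hjg hir
    have e1 := hF.sk i k
    have e2 := hF.sk j k
    have i_out : B i k < 0 := by
      rcases hF.ab i k hi with a | a
      · exact (not_red_green hir (ingreen i hi (by omega))).elim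
      · omega
    rcases hF.ab j k hj with a | a
    · have := path_big hF hk hj hi (by omega) (by omega)
      have := hF'.sk i j
      omega
    · rw [out_same hF hi hj (by omega) (by omega)] at hb
      have hjg' : QGreen C j := by simpa only [QGreen, outc j hj (by omega)] using hjg
      have hir' : QRed C i := by simpa only [QRed, outc i hi (by omega)] using hir
      by_cases e : i = r
      · subst e
        have := hF.fk k j (by omega) hb
        omega
      by_cases e' : j = r
      · subst e'
        exact not_red_green (h.s3' k hk (by omega) hg) hjg'
      exact not_red_green hir' (h.s4 i j hij e e' hb hjg')
  have s1' : ∀ i, QRed (mutC B C k) i ∨ QGreen (mutC B C k) i := by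
    intro i
    by_cases hi : i = k
    · subst hi; exact Or.inl kred
    rcases hF.ab i k hi with a | a
    · exact Or.inr (ingreen i hi (by omega))
    · simpa only [QRed, QGreen, outc i hi (by omega)] using h.s1 i
  refine ⟨s1', ?_, ?_, ?_, ?_, ?_, ?_⟩
  · intro j hj hb _
    rw [mutB_left] at hb
    have := hF.sk j k
    right
    intro t
    have h1 := big j hj (by omega) t
    rw [mutC_self, Pi.neg_apply, abs_neg, abs_of_nonneg (hg.1 t)]
    exact h1.trans (le_abs_self _)
  · intro j _ _ _
    exact Or.inl kred
  · intro j hj hb hr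
    rw [mutB_left] at hb
    have := hF.sk j k
    exact (not_red_green hr (ingreen j hj (by omega))).elim
  · intro j _ _ _
    exact kred
  · intro i j hij hi hj hb hgr
    exact (s1' i).resolve_left (main i j hij hi hj hb hgr)
  · intro i j hij hi hj hb hr
    have := hF'.sk i j
    exact (s1' i).resolve_right fun hgr => main j i hij.symm hj hi (by omega) hgr hr

theorem green_neg {C : Matrix V W ℤ} {i : V} : QGreen (-C) i ↔ QRed C i := by
  have e : (-C) i = -C i := rfl
  simp [QGreen, QRed, e]

theorem red_neg {C : Matrix V W ℤ} {i : V} : QRed (-C) i ↔ QGreen C i := by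
  have e : (-C) i = -C i := rfl
  simp [QGreen, QRed, e]

theorem fInv_neg {B : Matrix V V ℤ} {r : V} (h : FInv B r) : FInv (-B) r := by
  refine ⟨?_, ?_, ?_, ?_⟩
  · intro i j; simp [h.sk i j]
  · intro i j hij; have := h.ab i j hij; simp only [Matrix.neg_apply]; omega
  · intro i j l hi hj hl h1 h2 h3
    simp only [Matrix.neg_apply] at h1 h2 h3
    have := h.sk i j
    have := h.sk j l
    have := h.sk l i
    exact h.tr l j i hl hj hi (by omega) (by omega) (by omega)
  · intro i j h1 h2
    simp only [Matrix.neg_apply] at h1 h2 ⊢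
    have := h.sk i r
    have := h.sk r j
    have := h.sk i j
    have := h.fk j i (by omega) (by omega)
    omega

theorem sInv_neg {B : Matrix V V ℤ} {C : Matrix V W ℤ} {r : V} (h : SInv B C r) :
    SInv (-B) (-C) r := by
  refine ⟨?_, ?_, ?_, ?_, ?_, ?_, ?_⟩ <;>
    simp only [green_neg, red_neg, Matrix.neg_apply, abs_neg, Left.neg_pos_iff, Left.neg_neg_iff]
  · exact fun i => (h.s1 i).symm
  · exact h.s2'
  · exact h.s2
  · exact h.s3'
  · exact h.s3
  · exact h.s4'
  · exact h.s4

theorem mutB_neg (B : Matrix V V ℤ) (k : V) : mutB (-B) k = -mutB B k := by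
  ext i j
  simp only [mutB, Matrix.of_apply, Matrix.neg_apply, neg_mul_neg, Int.sign_neg]
  split_ifs <;> ring

theorem mutC_neg (B : Matrix V V ℤ) (C : Matrix V W ℤ) (k : V) :
    mutC (-B) (-C) k = -mutC B C k := by
  ext i j
  simp only [mutC, Matrix.of_apply, Matrix.neg_apply, neg_mul_neg, Int.sign_neg]
  split_ifs <;> ring

theorem sInv_step {B : Matrix V V ℤ} {C : Matrix V W ℤ} {r k : V} (hF : FInv B r)
    (h : SInv B C r) (hk : k ≠ r) : SInv (mutB B k) (mutC B C k) k := by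
  rcases h.s1 k with hr | hg
  · have := sInv_neg (sInv_step_green (fInv_neg hF) (sInv_neg h) hk (green_neg.2 hr))
    simpa only [mutB_neg, mutC_neg, neg_neg] using this
  · exact sInv_step_green hF h hk hg

theorem four_seq (w : List V) : ∀ (P : Matrix V V ℤ × Matrix V W ℤ) (r : V), FInv P.1 r →
    SInv P.1 P.2 r → List.IsChain (· ≠ ·) (r :: w) →
    FourConds (mutSeqPair P w).1 (mutSeqPair P w).2 ((r :: w).getLast (by simp)) := by
  induction w with
  | nil => intro P r hF hS _; exact four_of_sInv hF hS
  | cons k w ih =>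
    intro P r hF hS hc
    rw [List.isChain_cons_cons] at hc
    have := ih (mutPair P k) k (fInv_step hF hc.1.symm) (sInv_step hF hS hc.1.symm) hc.2
    simpa [mutSeqPair] using this

theorem fInv_of_fork {B : Matrix V V ℤ} {r : V} (sk : ∀ i j, B j i = -B i j)
    (h : QFork B r) : FInv B r := by
  obtain ⟨h1, _, h3, h4⟩ := h
  refine ⟨sk, ?_, ?_, h4⟩
  · intro i j hij
    have := h1 i j hij
    rcases le_abs.1 this with h | h
    · exact Or.inl h
    · right; omega
  · intro i j l hi hj hl a b c
    refine h3 ⟨i, [j, l], hi, ?_, ?_⟩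
    · simp [hj, hl]
    · simp [List.Chain, a, b, c]

end Aux

/-- Proposition `prop-control-signs-fork`. -/
theorem control_signs_fork {n m : ℕ}
    (B : Matrix (Fin n) (Fin n) ℤ) (C : Matrix (Fin n) (Fin m) ℤ)
    (hskew : ∀ i j, B j i = -B i j)
    (v : Fin n)
    (hfork : QFork (mutPair (B, C) v).1 v)
    (hbase : FourConds (mutPair (B, C) v).1 (mutPair (B, C) v).2 v)
    (w : List (Fin n)) (hw : w ≠ []) (hhead : w.head hw = v)
    (hreduced : List.Chain' (· ≠ ·) w) :
    FourConds (mutSeqPair (B, C) w).1 (mutSeqPair (B, C) w).2 (w.getLast hw) := by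
  cases w with
  | nil => exact absurd rfl hw
  | cons a w =>
    have ha : a = v := hhead
    subst ha
    exact four_seq w (mutPair (B, C) a) a (fInv_of_fork (mutB_skew hskew a) hfork)
      (sInv_of_four hbase) hreduced
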